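/- Let ν < 0 and let x₁, x₂ > 0. Then ∫_{Ω₃} exp(−tr(y⁻¹) − x₁·y₁₁ − x₂·y₂₂) (det y)^{ν−2} dy = 2π Γ(−ν) · ∫_{Ω₂} exp(−tr(z⁻¹) − x₁·z₁₁ − x₂·z₂₂) (det z)^{ν−1} dz; equivalently, K_ν^{[3]}(x₁c₁ + x₂c₂) = 2π Γ(−ν) K_{ν+1/2}^{[2]}(diag(x₁,x₂)), where c₁, c₂ are the diagonal matrix units. -/

import Mathlib

open MeasureTheory Real Matrix

noncomputable def poch (a : ℝ) (k : ℕ) : ℝ := ∏ i ∈ Finset.range k, (a + i)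

def sym3 (a b : Fin 3 → ℝ) : Matrix (Fin 3) (Fin 3) ℝ :=
  !![a 0, b 0, b 1;
     b 0, a 1, b 2;
     b 1, b 2, a 2]

noncomputable def K3 (ν : ℝ) (x : Matrix (Fin 3) (Fin 3) ℝ) : ℝ :=
  (Real.sqrt 2) ^ 3 *
    ∫ p in {p : (Fin 3 → ℝ) × (Fin 3 → ℝ) | (sym3 p.1 p.2).PosDef},
      Real.exp (-(sym3 p.1 p.2)⁻¹.trace - (x * sym3 p.1 p.2).trace) *
        (sym3 p.1 p.2).det ^ (ν - 2)

def sym2 (a : Fin 2 → ℝ) (b : ℝ) : Matrix (Fin 2) (Fin 2) ℝ := !![a 0, b; b, a 1]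

noncomputable def K2 (μ : ℝ) (x : Matrix (Fin 2) (Fin 2) ℝ) : ℝ :=
  Real.sqrt 2 *
    ∫ p in {p : (Fin 2 → ℝ) × ℝ | (sym2 p.1 p.2).PosDef},
      Real.exp (-(sym2 p.1 p.2)⁻¹.trace - (x * sym2 p.1 p.2).trace) *
        (sym2 p.1 p.2).det ^ (μ - 3/2)

noncomputable def J31 (d ν t₁ t₂ t₃ : ℝ) : ℝ :=
  ∑' m : ℕ × ℕ × ℕ,
    ((-1 : ℝ) ^ (m.1 + m.2.2) * poch (1 + 2*ν + d) (m.1 + 2*m.2.1 + 4*m.2.2)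
        * t₁ ^ m.1 * t₂ ^ m.2.1 * t₃ ^ m.2.2) /
      (poch 1 m.1 * poch 1 m.2.1 * poch 1 m.2.2 * poch (1 + ν) m.2.2
        * poch (1 + ν + d/2) (m.2.1 + 2*m.2.2)
        * poch (1 + ν + d) (m.1 + 2*m.2.1 + 3*m.2.2)
        * poch (1 + 2*ν + d) (m.1 + 2*m.2.1 + 3*m.2.2))

noncomputable def J32 (d ν t₁ t₂ t₃ : ℝ) : ℝ :=
  ∑' m : ℕ × ℕ × ℕ,
    ((-1 : ℝ) ^ (m.1 + m.2.2) * poch (1 + ν) (m.1 + 2*m.2.1 + 4*m.2.2)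
        * t₁ ^ ((m.1 : ℝ) - ν - d) * t₂ ^ m.2.1 * t₃ ^ m.2.2) /
      (poch (1 - ν - d) m.1 * poch 1 m.2.1 * poch 1 m.2.2 * poch (1 + ν) m.2.2
        * poch (1 + ν + d/2) (m.2.1 + 2*m.2.2)
        * poch 1 (m.1 + 2*m.2.1 + 3*m.2.2)
        * poch (1 + ν) (m.1 + 2*m.2.1 + 3*m.2.2))

noncomputable def J33 (d ν t₁ t₂ t₃ : ℝ) : ℝ :=
  ∑' m : ℕ × ℕ × ℕ,
    ((-1 : ℝ) ^ (m.1 + m.2.2) * poch 1 (m.1 + 2*m.2.1 + 4*m.2.2)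
        * t₁ ^ m.1 * t₂ ^ ((m.2.1 : ℝ) - ν - d/2) * t₃ ^ m.2.2) /
      (poch 1 m.1 * poch (1 - ν - d/2) m.2.1 * poch 1 m.2.2 * poch (1 + ν) m.2.2
        * poch 1 (m.2.1 + 2*m.2.2)
        * poch (1 - ν) (m.1 + 2*m.2.1 + 3*m.2.2)
        * poch 1 (m.1 + 2*m.2.1 + 3*m.2.2))

noncomputable def J34 (d ν t₁ t₂ t₃ : ℝ) : ℝ :=
  ∑' m : ℕ × ℕ × ℕ,
    ((-1 : ℝ) ^ (m.1 + m.2.2) * poch (1 + ν) (m.1 + 2*m.2.1 + 4*m.2.2)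
        * t₁ ^ ((m.1 : ℝ) + ν) * t₂ ^ ((m.2.1 : ℝ) - ν - d/2) * t₃ ^ m.2.2) /
      (poch (1 + ν) m.1 * poch (1 - ν - d/2) m.2.1 * poch 1 m.2.2 * poch (1 + ν) m.2.2
        * poch 1 (m.2.1 + 2*m.2.2)
        * poch 1 (m.1 + 2*m.2.1 + 3*m.2.2)
        * poch (1 + ν) (m.1 + 2*m.2.1 + 3*m.2.2))

noncomputable def J21 (d μ t₁ t₂ : ℝ) : ℝ :=
  ∑' m : ℕ × ℕ,
    ((-1 : ℝ) ^ m.1 * t₁ ^ m.1 * t₂ ^ m.2) /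
      (poch 1 m.1 * poch 1 m.2 * poch (1 + μ) m.2 * poch (1 + μ + d/2) (m.1 + 2*m.2))

noncomputable def J22 (d μ t₁ t₂ : ℝ) : ℝ :=
  ∑' m : ℕ × ℕ,
    ((-1 : ℝ) ^ m.1 * t₁ ^ ((m.1 : ℝ) - μ - d/2) * t₂ ^ m.2) /
      (poch (1 - μ - d/2) m.1 * poch 1 m.2 * poch (1 + μ) m.2 * poch 1 (m.1 + 2*m.2))

def herm3 (a : Fin 3 → ℝ) (b : Fin 3 → ℂ) : Matrix (Fin 3) (Fin 3) ℂ :=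
  !![(a 0 : ℂ), b 0, b 1;
     (starRingEnd ℂ) (b 0), (a 1 : ℂ), b 2;
     (starRingEnd ℂ) (b 1), (starRingEnd ℂ) (b 2), (a 2 : ℂ)]

theorem sym2_det (a : Fin 2 → ℝ) (b : ℝ) : (sym2 a b).det = a 0 * a 1 - b ^ 2 := by
  simp [sym2, det_fin_two, sq]

theorem sym3_det (a b : Fin 3 → ℝ) :
    (sym3 a b).det =
      a 0 * a 1 * a 2 + 2 * b 0 * b 1 * b 2 - a 0 * b 2 ^ 2 - a 1 * b 1 ^ 2 - a 2 * b 0 ^ 2 := by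
  simp [sym3, det_fin_three]
  ring

theorem sym2_inv_trace (a : Fin 2 → ℝ) (b : ℝ) :
    (sym2 a b)⁻¹.trace = (a 0 + a 1) / (sym2 a b).det := by
  rw [inv_def, trace_smul, Ring.inverse_eq_inv', smul_eq_mul, ← div_eq_inv_mul]
  congr 1
  simp [sym2, adjugate_fin_two, trace_fin_two, add_comm]

theorem sym3_inv_trace (a b : Fin 3 → ℝ) :
    (sym3 a b)⁻¹.trace =
      (a 0 * a 1 - b 0 ^ 2 + (a 0 * a 2 - b 1 ^ 2) + (a 1 * a 2 - b 2 ^ 2)) / (sym3 a b).det := by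
  rw [inv_def, trace_smul, Ring.inverse_eq_inv', smul_eq_mul, ← div_eq_inv_mul]
  congr 1
  simp [sym3, adjugate_fin_three, trace_fin_three]
  ring

theorem sym2_posDef_iff (a : Fin 2 → ℝ) (b : ℝ) :
    (sym2 a b).PosDef ↔ 0 < a 0 ∧ 0 < (sym2 a b).det := by
  refine ⟨fun h => ⟨by simpa [sym2] using h.diag_pos (i := 0), h.det_pos⟩, fun ⟨h₀, hd⟩ => ?_⟩
  rw [sym2_det] at hd
  refine .of_dotProduct_mulVec_pos (by ext i j; fin_cases i <;> fin_cases j <;> simp [sym2])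
    fun x hx => ?_
  have key : a 0 * (star x ⬝ᵥ sym2 a b *ᵥ x) =
      (a 0 * x 0 + b * x 1) ^ 2 + (a 0 * a 1 - b ^ 2) * x 1 ^ 2 := by
    simp [sym2, dotProduct, mulVec, Fin.sum_univ_two]
    ring
  refine pos_of_mul_pos_right (key ▸ ?_) h₀.le
  by_cases h₁ : x 1 = 0
  · have : x 0 ≠ 0 := fun h => hx (by ext i; fin_cases i <;> simp [h, h₁])
    rw [h₁]
    ring_nf
    positivity
  · positivity

theorem sym3_posDef_iff (a b : Fin 3 → ℝ) :
    (sym3 a b).PosDef ↔ (sym2 ![a 0, a 1] (b 0)).PosDef ∧ 0 < (sym3 a b).det := by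
  refine ⟨fun h => ⟨?_, h.det_pos⟩, fun ⟨h, hd⟩ => ?_⟩
  · have := h.submatrix (e := Fin.castSucc) (Fin.castSucc_injective 2)
    convert this using 1
    ext i j
    fin_cases i <;> fin_cases j <;> simp [sym2, sym3]
  obtain ⟨h₀, h₁⟩ := (sym2_posDef_iff _ _).1 h
  rw [sym2_det] at h₁
  rw [sym3_det] at hd
  simp only [cons_val_zero, cons_val_one] at h₀ h₁
  refine .of_dotProduct_mulVec_pos (by ext i j; fin_cases i <;> fin_cases j <;> simp [sym3])
    fun x hx => ?_
  have key : a 0 * (a 0 * a 1 - b 0 ^ 2) * (star x ⬝ᵥ sym3 a b *ᵥ x) =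
      (a 0 * a 1 - b 0 ^ 2) * (a 0 * x 0 + b 0 * x 1 + b 1 * x 2) ^ 2 +
      ((a 0 * a 1 - b 0 ^ 2) * x 1 + (a 0 * b 2 - b 0 * b 1) * x 2) ^ 2 +
      a 0 * (a 0 * a 1 * a 2 + 2 * b 0 * b 1 * b 2 - a 0 * b 2 ^ 2 - a 1 * b 1 ^ 2
        - a 2 * b 0 ^ 2) * x 2 ^ 2 := by
    simp [sym3, dotProduct, mulVec, Fin.sum_univ_three]
    ring
  refine pos_of_mul_pos_right (key ▸ ?_) (mul_pos h₀ h₁).le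
  by_cases h₂ : x 2 = 0
  · by_cases h₃ : x 1 = 0
    · have : x 0 ≠ 0 := fun h => hx (by ext i; fin_cases i <;> simp [h, h₂, h₃])
      simp only [h₂, h₃, mul_zero, add_zero]
      positivity
    · simp only [h₂, mul_zero, add_zero]
      positivity
  · positivity

theorem measurable_sym2_det : Measurable fun p : (Fin 2 → ℝ) × ℝ => (sym2 p.1 p.2).det := by
  simp only [sym2_det]
  fun_prop

theorem measurable_sym3_det :
    Measurable fun p : (Fin 3 → ℝ) × (Fin 3 → ℝ) => (sym3 p.1 p.2).det := by
  simp only [sym3_det]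
  fun_prop

theorem measurableSet_sym2_posDef :
    MeasurableSet {p : (Fin 2 → ℝ) × ℝ | (sym2 p.1 p.2).PosDef} := by
  simp only [sym2_posDef_iff]
  exact (measurableSet_lt measurable_const ((measurable_pi_apply 0).comp measurable_fst)).inter
    (measurableSet_lt measurable_const measurable_sym2_det)

theorem measurableSet_sym3_posDef :
    MeasurableSet {p : (Fin 3 → ℝ) × (Fin 3 → ℝ) | (sym3 p.1 p.2).PosDef} := by
  simp only [sym3_posDef_iff]
  have h : Measurable fun p : (Fin 3 → ℝ) × (Fin 3 → ℝ) =>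
      ((![p.1 0, p.1 1], p.2 0) : (Fin 2 → ℝ) × ℝ) := by fun_prop
  exact (h measurableSet_sym2_posDef).inter
    (measurableSet_lt measurable_const measurable_sym3_det)

/-- The integrand of `K2`, extended by zero outside the positive definite cone. -/
noncomputable def K2Density (μ : ℝ) (x : Matrix (Fin 2) (Fin 2) ℝ) (p : (Fin 2 → ℝ) × ℝ) : ℝ :=
  {p : (Fin 2 → ℝ) × ℝ | (sym2 p.1 p.2).PosDef}.indicator
    (fun p => Real.exp (-(sym2 p.1 p.2)⁻¹.trace - (x * sym2 p.1 p.2).trace) *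
      (sym2 p.1 p.2).det ^ (μ - 3/2)) p

/-- The integrand of `K3`, extended by zero outside the positive definite cone. -/
noncomputable def K3Density (ν : ℝ) (x : Matrix (Fin 3) (Fin 3) ℝ)
    (p : (Fin 3 → ℝ) × (Fin 3 → ℝ)) : ℝ :=
  {p : (Fin 3 → ℝ) × (Fin 3 → ℝ) | (sym3 p.1 p.2).PosDef}.indicator
    (fun p => Real.exp (-(sym3 p.1 p.2)⁻¹.trace - (x * sym3 p.1 p.2).trace) *
      (sym3 p.1 p.2).det ^ (ν - 2)) p

theorem K2Density_of_posDef {ν : ℝ} {x : Matrix (Fin 2) (Fin 2) ℝ}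
    {p : (Fin 2 → ℝ) × ℝ} (hp : (sym2 p.1 p.2).PosDef) :
    K2Density ν x p = Real.exp (-(sym2 p.1 p.2)⁻¹.trace - (x * sym2 p.1 p.2).trace) *
      (sym2 p.1 p.2).det ^ (ν - 3/2) :=
  Set.indicator_of_mem (s := {p : (Fin 2 → ℝ) × ℝ | (sym2 p.1 p.2).PosDef}) hp _

theorem K2Density_of_not_posDef {ν : ℝ} {x : Matrix (Fin 2) (Fin 2) ℝ}
    {p : (Fin 2 → ℝ) × ℝ} (hp : ¬ (sym2 p.1 p.2).PosDef) : K2Density ν x p = 0 :=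
  Set.indicator_of_notMem (s := {p : (Fin 2 → ℝ) × ℝ | (sym2 p.1 p.2).PosDef}) hp _

theorem K3Density_of_posDef {ν : ℝ} {x : Matrix (Fin 3) (Fin 3) ℝ}
    {p : (Fin 3 → ℝ) × (Fin 3 → ℝ)} (hp : (sym3 p.1 p.2).PosDef) :
    K3Density ν x p = Real.exp (-(sym3 p.1 p.2)⁻¹.trace - (x * sym3 p.1 p.2).trace) *
      (sym3 p.1 p.2).det ^ (ν - 2) :=
  Set.indicator_of_mem (s := {p : (Fin 3 → ℝ) × (Fin 3 → ℝ) | (sym3 p.1 p.2).PosDef}) hp _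

theorem K3Density_of_not_posDef {ν : ℝ} {x : Matrix (Fin 3) (Fin 3) ℝ}
    {p : (Fin 3 → ℝ) × (Fin 3 → ℝ)} (hp : ¬ (sym3 p.1 p.2).PosDef) : K3Density ν x p = 0 :=
  Set.indicator_of_notMem (s := {p : (Fin 3 → ℝ) × (Fin 3 → ℝ) | (sym3 p.1 p.2).PosDef}) hp _

theorem K2Density_nonneg (μ : ℝ) (x : Matrix (Fin 2) (Fin 2) ℝ) (p : (Fin 2 → ℝ) × ℝ) :
    0 ≤ K2Density μ x p :=
  Set.indicator_nonneg (fun _ hp => mul_nonneg (exp_nonneg _) (rpow_nonneg hp.det_pos.le _)) _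

theorem K3Density_nonneg (ν : ℝ) (x : Matrix (Fin 3) (Fin 3) ℝ)
    (p : (Fin 3 → ℝ) × (Fin 3 → ℝ)) : 0 ≤ K3Density ν x p :=
  Set.indicator_nonneg (fun _ hp => mul_nonneg (exp_nonneg _) (rpow_nonneg hp.det_pos.le _)) _

theorem measurable_K2Density (μ : ℝ) (x : Matrix (Fin 2) (Fin 2) ℝ) :
    Measurable (K2Density μ x) := by
  refine Measurable.indicator ?_ measurableSet_sym2_posDef
  refine Measurable.mul (measurable_exp.comp (Measurable.sub ?_ ?_))
    (measurable_sym2_det.pow_const _)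
  · simp only [sym2_inv_trace]
    exact (Measurable.div (by fun_prop) measurable_sym2_det).neg
  · simp only [sym2, trace_fin_two, mul_apply, Fin.sum_univ_two, of_apply, cons_val', cons_val_zero,
      cons_val_one, cons_val_fin_one]
    fun_prop

theorem measurable_K3Density (ν : ℝ) (x : Matrix (Fin 3) (Fin 3) ℝ) :
    Measurable (K3Density ν x) := by
  refine Measurable.indicator ?_ measurableSet_sym3_posDef
  refine Measurable.mul (measurable_exp.comp (Measurable.sub ?_ ?_))
    (measurable_sym3_det.pow_const _)
  · simp only [sym3_inv_trace]
    exact (Measurable.div (by fun_prop) measurable_sym3_det).neg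
  · simp only [sym3, trace_fin_three, mul_apply, Fin.sum_univ_three, of_apply, cons_val',
      cons_val_zero, cons_val_one, cons_val, cons_val_fin_one]
    fun_prop

theorem K2_eq_toReal_lintegral (μ : ℝ) (x : Matrix (Fin 2) (Fin 2) ℝ) :
    K2 μ x = Real.sqrt 2 * (∫⁻ p, ENNReal.ofReal (K2Density μ x p)).toReal := by
  rw [K2, ← integral_indicator measurableSet_sym2_posDef]
  congr 1
  exact integral_eq_lintegral_of_nonneg_ae (.of_forall (K2Density_nonneg μ x))
    (measurable_K2Density μ x).aestronglyMeasurable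

theorem K3_eq_toReal_lintegral (ν : ℝ) (x : Matrix (Fin 3) (Fin 3) ℝ) :
    K3 ν x = Real.sqrt 2 ^ 3 * (∫⁻ p, ENNReal.ofReal (K3Density ν x p)).toReal := by
  rw [K3, ← integral_indicator measurableSet_sym3_posDef]
  congr 1
  exact integral_eq_lintegral_of_nonneg_ae (.of_forall (K3Density_nonneg ν x))
    (measurable_K3Density ν x).aestronglyMeasurable

open ENNReal in
theorem lintegral_fin_three_last (F : (Fin 3 → ℝ) → ℝ≥0∞) (hF : Measurable F) :
    ∫⁻ a, F a = ∫⁻ t : ℝ, ∫⁻ a : Fin 2 → ℝ, F ![a 0, a 1, t] := by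
  rw [← (volume_preserving_piFinSuccAbove (fun _ : Fin 3 => ℝ) (Fin.last 2)).symm.lintegral_comp hF,
    Measure.volume_eq_prod, lintegral_prod _ (by fun_prop)]
  refine lintegral_congr fun t => lintegral_congr fun a => congrArg F ?_
  ext i
  fin_cases i <;> rfl

open ENNReal in
theorem lintegral_fin_three_zero (F : (Fin 3 → ℝ) → ℝ≥0∞) (hF : Measurable F) :
    ∫⁻ a, F a = ∫⁻ t : ℝ, ∫⁻ a : Fin 2 → ℝ, F ![t, a 0, a 1] := by
  rw [← (volume_preserving_piFinSuccAbove (fun _ : Fin 3 => ℝ) 0).symm.lintegral_comp hF,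
    Measure.volume_eq_prod, lintegral_prod _ (by fun_prop)]
  refine lintegral_congr fun t => lintegral_congr fun a => congrArg F ?_
  ext i
  fin_cases i <;> rfl

open ENNReal in
theorem lintegral_sym3_coords (F : (Fin 3 → ℝ) × (Fin 3 → ℝ) → ℝ≥0∞) (hF : Measurable F) :
    ∫⁻ p, F p = ∫⁻ z : (Fin 2 → ℝ) × ℝ, ∫⁻ w : Fin 2 → ℝ, ∫⁻ t : ℝ,
      F (![z.1 0, z.1 1, t], ![z.2, w 0, w 1]) := by
  rw [Measure.volume_eq_prod, lintegral_prod _ hF.aemeasurable,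
    lintegral_fin_three_last _ (by fun_prop), Measure.volume_eq_prod,
    lintegral_prod _ (by fun_prop), lintegral_lintegral_swap (by fun_prop)]
  refine lintegral_congr fun a => ?_
  simp_rw [fun t => lintegral_fin_three_zero (fun b => F (![a 0, a 1, t], b)) (by fun_prop)]
  rw [lintegral_lintegral_swap (by fun_prop)]
  refine lintegral_congr fun c => ?_
  rw [lintegral_lintegral_swap (by fun_prop)]

open ENNReal in
theorem lintegral_mulVec (M : Matrix (Fin 2) (Fin 2) ℝ) (hM : 0 < M.det)
    (F : (Fin 2 → ℝ) → ℝ≥0∞) (hF : Measurable F) :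
    ∫⁻ w, F w = ENNReal.ofReal M.det * ∫⁻ u, F (M *ᵥ u) := by
  have h := Real.map_matrix_volume_pi_eq_smul_volume_pi hM.ne'
  have h' : ∫⁻ u, F (M *ᵥ u) = ENNReal.ofReal (M.det)⁻¹ * ∫⁻ w, F w := by
    rw [← abs_of_pos (inv_pos.2 hM), ← smul_eq_mul, ← lintegral_smul_measure, ← h,
      lintegral_map hF (LinearMap.continuous_of_finiteDimensional _).measurable]
    rfl
  rw [h', ← mul_assoc, ← ENNReal.ofReal_mul hM.le, mul_inv_cancel₀ hM.ne', ENNReal.ofReal_one,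
    one_mul]

theorem lintegral_gaussian_fin_two {b : ℝ} (hb : 0 < b) :
    ∫⁻ u : Fin 2 → ℝ, ENNReal.ofReal (exp (-b * (u 0 ^ 2 + u 1 ^ 2))) = ENNReal.ofReal (π / b) := by
  rw [← (volume_preserving_finTwoArrow ℝ).symm.lintegral_comp (by fun_prop),
    Measure.volume_eq_prod]
  have h : ∀ p : ℝ × ℝ, ENNReal.ofReal (exp (-b *
      ((MeasurableEquiv.finTwoArrow.symm p : Fin 2 → ℝ) 0 ^ 2
        + (MeasurableEquiv.finTwoArrow.symm p : Fin 2 → ℝ) 1 ^ 2))) =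
      ENNReal.ofReal (exp (-b * p.1 ^ 2)) * ENNReal.ofReal (exp (-b * p.2 ^ 2)) := fun p => by
    rw [← ENNReal.ofReal_mul (exp_nonneg _), ← exp_add, ← mul_add]
    rfl
  simp_rw [h]
  rw [lintegral_prod_mul (f := fun t : ℝ => ENNReal.ofReal (exp (-b * t ^ 2)))
      (g := fun t : ℝ => ENNReal.ofReal (exp (-b * t ^ 2))) (by fun_prop) (by fun_prop),
    ← ofReal_integral_eq_lintegral_ofReal (integrable_exp_neg_mul_sq hb)
      (.of_forall fun _ => exp_nonneg _),
    integral_gaussian, ← ENNReal.ofReal_mul (sqrt_nonneg _), mul_self_sqrt (by positivity)]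

theorem integral_rpow_mul_exp_neg_inv {ν : ℝ} (hν : ν < 0) :
    ∫ s in Set.Ioi (0 : ℝ), s ^ (ν - 1) * exp (-s⁻¹) = Gamma (-ν) := by
  rw [Gamma_eq_integral (neg_pos.2 hν), ← integral_comp_rpow_Ioi _ (neg_ne_zero.2 one_ne_zero)]
  refine setIntegral_congr_fun measurableSet_Ioi fun s (hs : 0 < s) => ?_
  simp only [abs_neg, abs_one, one_mul, smul_eq_mul]
  rw [← rpow_mul hs.le, rpow_neg_one, inv_inv, ← mul_assoc, ← rpow_add hs, mul_comm]
  ring_nf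

theorem K3Density_schur (ν x₁ x₂ : ℝ) {a : Fin 2 → ℝ} {c : ℝ} (h : (sym2 a c).PosDef)
    (u : Fin 2 → ℝ) (s : ℝ) :
    (sym2 a c).det * K3Density ν (Matrix.diagonal ![x₁, x₂, 0])
      (![a 0, a 1, s + u ⬝ᵥ sym2 a c *ᵥ u], ![c, (sym2 a c *ᵥ u) 0, (sym2 a c *ᵥ u) 1]) =
    K2Density (ν + 1/2) (Matrix.diagonal ![x₁, x₂]) (a, c) *
      (Set.Ioi 0).indicator
        (fun s => s ^ (ν - 2) * exp (-s⁻¹) * exp (-s⁻¹ * (u 0 ^ 2 + u 1 ^ 2))) s := by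
  have hd := h.det_pos
  have ha : ![a 0, a 1] = a := by ext i; fin_cases i <;> rfl
  have hdet : (sym3 ![a 0, a 1, s + u ⬝ᵥ sym2 a c *ᵥ u]
      ![c, (sym2 a c *ᵥ u) 0, (sym2 a c *ᵥ u) 1]).det = (sym2 a c).det * s := by
    simp [sym3_det, sym2, mulVec, dotProduct, Fin.sum_univ_two]
    ring
  by_cases hs : 0 < s
  · have hp : (sym3 ![a 0, a 1, s + u ⬝ᵥ sym2 a c *ᵥ u]
        ![c, (sym2 a c *ᵥ u) 0, (sym2 a c *ᵥ u) 1]).PosDef := by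
      rw [sym3_posDef_iff, hdet]
      exact ⟨by simpa [ha] using h, by positivity⟩
    have htr : (sym3 ![a 0, a 1, s + u ⬝ᵥ sym2 a c *ᵥ u]
        ![c, (sym2 a c *ᵥ u) 0, (sym2 a c *ᵥ u) 1])⁻¹.trace =
        (sym2 a c)⁻¹.trace + s⁻¹ * (1 + u 0 ^ 2 + u 1 ^ 2) := by
      rw [sym3_inv_trace, sym2_inv_trace, hdet]
      field_simp
      simp [sym2, mulVec, dotProduct, Fin.sum_univ_two]
      ring
    have hx : (Matrix.diagonal ![x₁, x₂, 0] * sym3 ![a 0, a 1, s + u ⬝ᵥ sym2 a c *ᵥ u]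
        ![c, (sym2 a c *ᵥ u) 0, (sym2 a c *ᵥ u) 1]).trace =
        (Matrix.diagonal ![x₁, x₂] * sym2 a c).trace := by
      simp [trace_fin_three, trace_fin_two, sym3, sym2]
    rw [K3Density_of_posDef hp, K2Density_of_posDef h,
      Set.indicator_of_mem (Set.mem_Ioi.2 hs)]
    simp only [htr, hx, hdet]
    rw [mul_rpow hd.le hs.le, show ν + 1 / 2 - 3 / 2 = 1 + (ν - 2) by ring, rpow_add hd, rpow_one,
      show -((sym2 a c)⁻¹.trace + s⁻¹ * (1 + u 0 ^ 2 + u 1 ^ 2)) -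
          (Matrix.diagonal ![x₁, x₂] * sym2 a c).trace =
        (-(sym2 a c)⁻¹.trace - (Matrix.diagonal ![x₁, x₂] * sym2 a c).trace) + -s⁻¹ +
          -s⁻¹ * (u 0 ^ 2 + u 1 ^ 2) by ring, exp_add, exp_add]
    ring
  · have hp : ¬ (sym3 ![a 0, a 1, s + u ⬝ᵥ sym2 a c *ᵥ u]
        ![c, (sym2 a c *ᵥ u) 0, (sym2 a c *ᵥ u) 1]).PosDef := fun hp =>
      hs (pos_of_mul_pos_right (hp.det_pos.trans_eq hdet) hd.le)
    rw [K3Density_of_not_posDef hp,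
      Set.indicator_of_notMem (by simpa using hs), mul_zero, mul_zero]

theorem lintegral_gaussian_gamma (ν : ℝ) :
    ∫⁻ u : Fin 2 → ℝ, ∫⁻ s : ℝ, ENNReal.ofReal ((Set.Ioi 0).indicator
        (fun s => s ^ (ν - 2) * exp (-s⁻¹) * exp (-s⁻¹ * (u 0 ^ 2 + u 1 ^ 2))) s) =
      ENNReal.ofReal π * ∫⁻ s in Set.Ioi (0 : ℝ), ENNReal.ofReal (s ^ (ν - 1) * exp (-s⁻¹)) := by
  have h (u : Fin 2 → ℝ) : ∫⁻ s : ℝ, ENNReal.ofReal ((Set.Ioi 0).indicator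
        (fun s => s ^ (ν - 2) * exp (-s⁻¹) * exp (-s⁻¹ * (u 0 ^ 2 + u 1 ^ 2))) s) =
      ∫⁻ s in Set.Ioi (0 : ℝ),
        ENNReal.ofReal (s ^ (ν - 2) * exp (-s⁻¹) * exp (-s⁻¹ * (u 0 ^ 2 + u 1 ^ 2))) := by
    rw [← lintegral_indicator measurableSet_Ioi]
    refine lintegral_congr fun s => ?_
    by_cases hs : s ∈ Set.Ioi (0 : ℝ) <;> simp [hs]
  simp_rw [h]
  rw [lintegral_lintegral_swap (by fun_prop), ← lintegral_const_mul _ (by fun_prop)]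
  refine setLIntegral_congr_fun measurableSet_Ioi fun s (hs : 0 < s) => ?_
  have hnn : 0 ≤ s ^ (ν - 2) * exp (-s⁻¹) := by positivity
  simp_rw [ENNReal.ofReal_mul hnn]
  rw [lintegral_const_mul _ (by fun_prop), lintegral_gaussian_fin_two (inv_pos.2 hs),
    ← ENNReal.ofReal_mul hnn, ← ENNReal.ofReal_mul pi_nonneg]
  congr 1
  rw [show ν - 1 = ν - 2 + 1 by ring, rpow_add hs, rpow_one, div_inv_eq_mul]
  ring

theorem lintegral_K3Density_fiber (ν x₁ x₂ : ℝ) (z : (Fin 2 → ℝ) × ℝ) :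
    ∫⁻ w : Fin 2 → ℝ, ∫⁻ t : ℝ, ENNReal.ofReal (K3Density ν (Matrix.diagonal ![x₁, x₂, 0])
        (![z.1 0, z.1 1, t], ![z.2, w 0, w 1])) =
      ENNReal.ofReal (K2Density (ν + 1/2) (Matrix.diagonal ![x₁, x₂]) z) *
        (ENNReal.ofReal π *
          ∫⁻ s in Set.Ioi (0 : ℝ), ENNReal.ofReal (s ^ (ν - 1) * exp (-s⁻¹))) := by
  obtain ⟨a, c⟩ := z
  have hmeas := measurable_K3Density ν (Matrix.diagonal ![x₁, x₂, 0])
  by_cases h : (sym2 a c).PosDef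
  · rw [lintegral_mulVec (sym2 a c) h.det_pos _ (by fun_prop),
      ← lintegral_const_mul _ (by fun_prop), ← lintegral_gaussian_gamma,
      ← lintegral_const_mul' _ _ ENNReal.ofReal_ne_top]
    refine lintegral_congr fun u => ?_
    rw [← lintegral_add_right_eq_self _ (u ⬝ᵥ sym2 a c *ᵥ u),
      ← lintegral_const_mul' _ _ ENNReal.ofReal_ne_top,
      ← lintegral_const_mul' _ _ ENNReal.ofReal_ne_top]
    refine lintegral_congr fun s => ?_
    rw [← ENNReal.ofReal_mul h.det_pos.le, ← ENNReal.ofReal_mul (K2Density_nonneg _ _ _),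
      ← K3Density_schur ν x₁ x₂ h u s]
  · have h₃ (w : Fin 2 → ℝ) (t : ℝ) : K3Density ν (Matrix.diagonal ![x₁, x₂, 0])
        (![a 0, a 1, t], ![c, w 0, w 1]) = 0 := by
      refine K3Density_of_not_posDef fun hp => h ?_
      convert ((sym3_posDef_iff _ _).1 hp).1 using 1
      ext i j
      fin_cases i <;> fin_cases j <;> simp [sym2]
    have h₂ : K2Density (ν + 1/2) (Matrix.diagonal ![x₁, x₂]) (a, c) = 0 :=
      K2Density_of_not_posDef h
    simp only [h₂, h₃, ENNReal.ofReal_zero, lintegral_zero, zero_mul]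

theorem K3_boundary_reduction (ν : ℝ) (hν : ν < 0) (x₁ x₂ : ℝ) (hx₁ : 0 < x₁) (hx₂ : 0 < x₂) :
    K3 ν (Matrix.diagonal ![x₁, x₂, 0]) =
      2 * π * Gamma (-ν) * K2 (ν + 1/2) (Matrix.diagonal ![x₁, x₂]) := by
  have hmeas₃ := measurable_K3Density ν (Matrix.diagonal ![x₁, x₂, 0])
  have hmeas₂ := measurable_K2Density (ν + 1/2) (Matrix.diagonal ![x₁, x₂])
  rw [K3_eq_toReal_lintegral, K2_eq_toReal_lintegral, lintegral_sym3_coords _ (by fun_prop)]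
  simp_rw [lintegral_K3Density_fiber]
  rw [lintegral_mul_const _ (by fun_prop), ENNReal.toReal_mul, ENNReal.toReal_mul,
    ENNReal.toReal_ofReal pi_nonneg, ← integral_rpow_mul_exp_neg_inv hν,
    integral_eq_lintegral_of_nonneg_ae (μ := volume.restrict _), pow_succ, sq_sqrt zero_le_two]
  · ring
  · filter_upwards [ae_restrict_mem measurableSet_Ioi] with s (hs : 0 < s)
    simp only [Pi.zero_apply]
    positivity
  · exact Measurable.aestronglyMeasurable (by fun_prop)
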